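/- arXiv:1812.09200 — 2 statements merged into one kernel-verified Lean document; each statement's English description precedes it below -/
import Mathlib

section
/- (Upper bound, Theorem 1.1.C) Let (L_n) and (h_n) be sequences of positive reals with L_n → 1 and h_n → 0. For every φ_* ∈ V there exists a sequence (φ_n) ⊂ V converging to φ_* strongly in H²(Ω) such that lim_{n→∞} F_{L_n,h_n}(φ_n) = F_*(φ_*), where F_*(φ) = ∫_Ω ( ½(αφ + Δ'φ)² + W(φ) ) dx if φ ∈ V_* and F_*(φ) = +∞ if φ ∈ V \ V_*. (In fact the constant sequence φ_n = φ_* works.) -/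
open MeasureTheory Filter Real

noncomputable section

abbrev Pt (d : ℕ) := Fin d → ℝ

/-- partial derivative in direction `i` -/
def pd {d : ℕ} (i : Fin d) (f : Pt d → ℝ) (x : Pt d) : ℝ := fderiv ℝ f x (Pi.single i 1)

/-- second partial derivative ∂ᵢ∂ⱼ -/
def pd2 {d : ℕ} (i j : Fin d) (f : Pt d → ℝ) : Pt d → ℝ := pd i (pd j f)

/-- the unit cube, the fundamental domain of the torus -/
def cube (d : ℕ) : Set (Pt d) := Set.Icc 0 1

/-- in-plane Laplacian Δ' = ∂₁₁ + ∂₂₂ -/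
def lap' (f : Pt 3 → ℝ) (x : Pt 3) : ℝ := pd2 0 0 f x + pd2 1 1 f x

/-- 1-periodicity in the two in-plane variables -/
def InPlanePeriodic (f : Pt 3 → ℝ) : Prop :=
  ∀ x : Pt 3, f (x + Pi.single 0 1) = f x ∧ f (x + Pi.single 1 1) = f x

structure MemV (m : ℝ) (f : Pt 3 → ℝ) : Prop where
  smooth : ContDiff ℝ 2 f
  periodic : InPlanePeriodic f
  bc : ∀ x : Pt 3, x 2 = 0 ∨ x 2 = 1 → pd 2 f x = 0
  mass : (∫ x in cube 3, f x) = m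

def MemVstar (m : ℝ) (f : Pt 3 → ℝ) : Prop :=
  MemV m f ∧ ∀ x ∈ cube 3, pd 2 f x = 0

/-- rescaled energy F_{L,h} -/
def FLh (α : ℝ) (W : ℝ → ℝ) (L h : ℝ) (f : Pt 3 → ℝ) : ℝ :=
  ∫ x in cube 3,
    ((1/2) * (α * f x + (1/L^2) * lap' f x + (1/(L^2*h^2)) * pd2 2 2 f x)^2 + W (f x))

def H2normSq (f : Pt 3 → ℝ) : ℝ :=
  ∫ x in cube 3, ((f x)^2 + ∑ i, (pd i f x)^2 + ∑ i, ∑ j, (pd2 i j f x)^2)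

def H2inner (f g : Pt 3 → ℝ) : ℝ :=
  ∫ x in cube 3,
    (f x * g x + ∑ i, pd i f x * pd i g x + ∑ i, ∑ j, pd2 i j f x * pd2 i j g x)

/-- weak convergence in H²(Ω): boundedness plus convergence of inner products
against all test functions in H² (C² functions being dense). -/
def WeakH2 (fs : ℕ → Pt 3 → ℝ) (f : Pt 3 → ℝ) : Prop :=
  (∃ M : ℝ, ∀ n, H2normSq (fs n) ≤ M) ∧
  ∀ g : Pt 3 → ℝ, ContDiff ℝ 2 g →
    Tendsto (fun n => H2inner (fs n) g) atTop (nhds (H2inner f g))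

/-- α ∉ {|k|² : k ∈ 2πℤ² \ {0}} -/
def AlphaAdmissible (α : ℝ) : Prop :=
  ∀ k : ℤ × ℤ, k ≠ 0 → α ≠ 4*π^2*((k.1 : ℝ)^2 + (k.2 : ℝ)^2)

/-- W continuous and liminf_{|s|→∞} W(s) > -∞ -/
def WAdmissible (W : ℝ → ℝ) : Prop :=
  Continuous W ∧ Filter.IsBoundedUnder (· ≥ ·) (Filter.cocompact ℝ) W

open Classical in
/-- limit functional F_* (with value +∞ outside V_*) -/
def FStar (m α : ℝ) (W : ℝ → ℝ) (f : Pt 3 → ℝ) : EReal :=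
  if MemVstar m f then
    (((∫ x in cube 3, ((1/2) * (α * f x + lap' f x)^2 + W (f x))) : ℝ) : EReal)
  else ⊤

lemma ub_pd_contDiff {f : Pt 3 → ℝ} (hf : ContDiff ℝ 2 f) (j : Fin 3) : ContDiff ℝ 1 (pd j f) := by
  have h1 : ContDiff ℝ 1 (fderiv ℝ f) := hf.fderiv_right (by norm_num)
  exact h1.clm_apply contDiff_const

lemma ub_pd2_cont {f : Pt 3 → ℝ} (hf : ContDiff ℝ 2 f) (i j : Fin 3) : Continuous (pd2 i j f) := by
  have h1 : Continuous (fderiv ℝ (pd j f)) := (ub_pd_contDiff hf j).continuous_fderiv (by norm_num)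
  exact h1.clm_apply continuous_const

lemma ub_curve {g : Pt 3 → ℝ} (hg : ContDiff ℝ 1 g) (x : Pt 3) (t : ℝ) :
    HasDerivAt (fun s : ℝ => g (Function.update x 2 s)) (pd 2 g (Function.update x 2 t)) t := by
  have h1 : HasFDerivAt g (fderiv ℝ g (Function.update x 2 t)) (Function.update x 2 t) :=
    (hg.differentiable (by norm_num) _).hasFDerivAt
  have h2 : HasDerivAt (fun s : ℝ => Function.update x 2 s) (Pi.single 2 1) t :=
    hasDerivAt_update x 2 t
  exact h1.comp_hasDerivAt t h2

lemma ub_mem {x : Pt 3} (hx : x ∈ cube 3) {t : ℝ} (ht : t ∈ Set.Icc (0:ℝ) 1) :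
    Function.update x 2 t ∈ cube 3 := by
  refine ⟨fun i => ?_, fun i => ?_⟩
  · by_cases h : i = 2
    · subst h; simpa using ht.1
    · simpa [Function.update_of_ne h] using hx.1 i
  · by_cases h : i = 2
    · subst h; simpa using ht.2
    · simpa [Function.update_of_ne h] using hx.2 i

lemma ub_w_zero {f : Pt 3 → ℝ} (hf : ContDiff ℝ 2 f) (h : ∀ x ∈ cube 3, pd 2 f x = 0) :
    ∀ x ∈ cube 3, pd2 2 2 f x = 0 := by
  intro x hx
  have hx2 : x 2 ∈ Set.Icc (0:ℝ) 1 := ⟨hx.1 2, hx.2 2⟩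
  have h1 := (ub_curve (ub_pd_contDiff hf 2) x (x 2)).hasDerivWithinAt (s := Set.Icc (0:ℝ) 1)
  have h2 : HasDerivWithinAt (fun s : ℝ => pd 2 f (Function.update x 2 s)) 0
      (Set.Icc (0:ℝ) 1) (x 2) :=
    (hasDerivWithinAt_const (x 2) _ (0:ℝ)).congr (fun s hs => h _ (ub_mem hx hs))
      (h _ (ub_mem hx hx2))
  have h3 := (uniqueDiffOn_Icc (zero_lt_one' ℝ) (x 2) hx2).eq_deriv _ h1 h2
  rw [Function.update_eq_self] at h3
  exact h3

lemma ub_pd_zero {m : ℝ} {f : Pt 3 → ℝ} (hf : MemV m f) (h : ∀ x ∈ cube 3, pd2 2 2 f x = 0) :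
    ∀ x ∈ cube 3, pd 2 f x = 0 := by
  intro x hx
  have hx2 : x 2 ∈ Set.Icc (0:ℝ) 1 := ⟨hx.1 2, hx.2 2⟩
  have hd := ub_curve (ub_pd_contDiff hf.smooth 2) x
  have := constant_of_has_deriv_right_zero (a := (0:ℝ)) (b := 1)
    (f := fun s : ℝ => pd 2 f (Function.update x 2 s))
    (fun t _ => (hd t).continuousAt.continuousWithinAt)
    (fun t ht => by
      have h1 := (hd t).hasDerivWithinAt (s := Set.Ici t)
      have h2 : pd 2 (pd 2 f) (Function.update x 2 t) = 0 := h _ (ub_mem hx ⟨ht.1, ht.2.le⟩)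
      rwa [h2] at h1) (x 2) hx2
  simp only [Function.update_eq_self] at this
  rw [this]
  exact hf.bc _ (Or.inl (by simp))

lemma ub_cube_closure : cube 3 ⊆ closure (interior (cube 3)) := by
  have : cube 3 = Set.pi Set.univ (fun _ => Set.Icc (0:ℝ) 1) := by
    ext x; simp [cube, Set.mem_Icc, Pi.le_def]
  rw [this, interior_pi_set Set.finite_univ, closure_pi_set]
  simp [closure_Ioo]

lemma ub_cube_compact : IsCompact (cube 3) := isCompact_Icc

lemma ub_int {g : Pt 3 → ℝ} (hg : Continuous g) : IntegrableOn g (cube 3) :=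
  hg.continuousOn.integrableOn_compact ub_cube_compact

lemma ub_int_pos {w : Pt 3 → ℝ} (hw : Continuous w) (h : ¬ ∀ x ∈ cube 3, w x = 0) :
    0 < ∫ x in cube 3, (w x)^2 := by
  have h0 : 0 ≤ ∫ x in cube 3, (w x)^2 := integral_nonneg fun x => sq_nonneg _
  refine lt_of_le_of_ne h0 fun he => h ?_
  have h1 := (integral_eq_zero_iff_of_nonneg (μ := volume.restrict (cube 3))
    (f := fun x => (w x)^2) (fun x => sq_nonneg _) (ub_int (hw.pow 2))).1 he.symm
  have h2 := Measure.eqOn_of_ae_eq h1 (hw.pow 2).continuousOn continuousOn_const ub_cube_closure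
  intro x hx
  simpa using h2 hx

lemma ub_expand {u v w z : Pt 3 → ℝ} (hu : Continuous u) (hv : Continuous v) (hw : Continuous w)
    (hz : Continuous z) (a c : ℝ) :
    (∫ x in cube 3, ((1/2) * (u x + a * v x + c * w x)^2 + z x)) =
      (∫ x in cube 3, ((1/2) * (u x)^2 + z x)) + a * (∫ x in cube 3, u x * v x)
      + a^2 * (∫ x in cube 3, (1/2) * (v x)^2)
      + c * (c * ((1/2) * ∫ x in cube 3, (w x)^2)
        + ((∫ x in cube 3, u x * w x) + a * ∫ x in cube 3, v x * w x)) := by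
  have i1 : IntegrableOn (fun x => (1/2) * (u x)^2 + z x) (cube 3) := ub_int (by fun_prop)
  have i2 : IntegrableOn (fun x => a * (u x * v x)) (cube 3) := ub_int (by fun_prop)
  have i3 : IntegrableOn (fun x => a^2 * ((1/2) * (v x)^2)) (cube 3) := ub_int (by fun_prop)
  have i4 : IntegrableOn (fun x => (c * c * (1/2)) * (w x)^2) (cube 3) := ub_int (by fun_prop)
  have i5 : IntegrableOn (fun x => c * (u x * w x)) (cube 3) := ub_int (by fun_prop)
  have i6 : IntegrableOn (fun x => c * a * (v x * w x)) (cube 3) := ub_int (by fun_prop)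
  have e : (fun x => (1/2) * (u x + a * v x + c * w x)^2 + z x) = fun x =>
      ((((((1/2) * (u x)^2 + z x) + a * (u x * v x)) + a^2 * ((1/2) * (v x)^2))
      + (c * c * (1/2)) * (w x)^2) + c * (u x * w x)) + c * a * (v x * w x) := by
    funext x; ring
  rw [e, integral_add (ub_int (by fun_prop)) i6,
    integral_add (ub_int (by fun_prop)) i5, integral_add (ub_int (by fun_prop)) i4,
    integral_add (ub_int (by fun_prop)) i3, integral_add i1 i2]
  simp only [integral_const_mul]
  ring

/-- Theorem 1.1.C (Upper bound): existence of a recovery sequence converging strongly in H². -/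
theorem upper_bound (m α : ℝ) (W : ℝ → ℝ)
    (hα : AlphaAdmissible α) (hW : WAdmissible W)
    (L h : ℕ → ℝ) (hLpos : ∀ n, 0 < L n) (hhpos : ∀ n, 0 < h n)
    (hL1 : Tendsto L atTop (nhds 1)) (hh0 : Tendsto h atTop (nhds 0))
    (φs : Pt 3 → ℝ) (hφs : MemV m φs) :
    ∃ φ : ℕ → Pt 3 → ℝ, (∀ n, MemV m (φ n)) ∧
      Tendsto (fun n => H2normSq (fun x => φ n x - φs x)) atTop (nhds 0) ∧
      Tendsto (fun n => ((FLh α W (L n) (h n) (φ n) : ℝ) : EReal)) atTop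
        (nhds (FStar m α W φs)) := by
  have hf := hφs.smooth
  have hfc : Continuous φs := hf.continuous
  have hu : Continuous (fun x => α * φs x) := by fun_prop
  have hv : Continuous (lap' φs) := (ub_pd2_cont hf 0 0).add (ub_pd2_cont hf 1 1)
  have hw : Continuous (pd2 2 2 φs) := ub_pd2_cont hf 2 2
  have hz : Continuous (fun x => W (φs x)) := hW.1.comp hfc
  refine ⟨fun _ => φs, fun _ => hφs, ?_, ?_⟩
  · have h0 : ∀ i : Fin 3, pd i (fun _ : Pt 3 => (0:ℝ)) = fun _ => 0 := by
      intro i; funext x; simp [pd]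
    simp [H2normSq, pd2, h0]
  · have ha : Tendsto (fun n => 1 / L n ^ 2) atTop (nhds 1) := by
      have := (hL1.pow 2).inv₀ (by norm_num)
      simpa using this
    have hE := fun n => ub_expand hu hv hw hz (1 / L n ^ 2) (1 / (L n ^ 2 * h n ^ 2))
    by_cases hs : MemVstar m φs
    · have hw0 := ub_w_zero hf hs.2
      rw [FStar, if_pos hs]
      refine (continuous_coe_real_ereal.tendsto _).comp ?_
      have hn : ∀ n, FLh α W (L n) (h n) φs = ∫ x in cube 3,
          ((1/2) * (α * φs x + (1 / L n ^ 2) * lap' φs x + 0 * pd2 2 2 φs x)^2 + W (φs x)) := by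
        intro n
        refine setIntegral_congr_fun ub_cube_compact.measurableSet fun x hx => ?_
        simp [hw0 x hx]
      have hl := ub_expand hu hv hw hz 1 0
      simp only [hn, fun n => ub_expand hu hv hw hz (1 / L n ^ 2) 0]
      simp only [one_mul, zero_mul, add_zero, one_pow] at hl ⊢
      rw [hl]
      have := (tendsto_const_nhds (x := ∫ x in cube 3, ((1/2) * (α * φs x)^2 + W (φs x)))).add
        (ha.mul_const (∫ x in cube 3, α * φs x * lap' φs x)) |>.add
        ((ha.pow 2).mul_const (∫ x in cube 3, (1/2) * (lap' φs x)^2))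
      simpa only [one_mul, one_pow] using this
    · rw [FStar, if_neg hs]
      have hpos := ub_int_pos hw fun h0 => hs ⟨hφs, ub_pd_zero hφs h0⟩
      have hc : Tendsto (fun n => 1 / (L n ^ 2 * h n ^ 2)) atTop atTop := by
        have h1 : Tendsto (fun n => L n ^ 2 * h n ^ 2) atTop (nhds 0) := by
          simpa using (hL1.pow 2).mul (hh0.pow 2)
        have h2 : Tendsto (fun n => L n ^ 2 * h n ^ 2) atTop (nhdsWithin 0 (Set.Ioi 0)) :=
          tendsto_nhdsWithin_iff.2 ⟨h1, Eventually.of_forall fun n => by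
            have := hLpos n
            have := hhpos n
            exact Set.mem_Ioi.2 (by positivity)⟩
        simp only [one_div]
        exact h2.inv_tendsto_nhdsGT_zero
      refine EReal.tendsto_coe_nhds_top_iff.2 ?_
      unfold FLh
      simp only [hE]
      refine Tendsto.add_atTop
        (((tendsto_const_nhds).add (ha.mul_const _)).add ((ha.pow 2).mul_const _)) ?_
      refine hc.atTop_mul_atTop₀ ?_
      exact (hc.atTop_mul_const (by positivity)).atTop_add
        (tendsto_const_nhds.add (ha.mul_const _))


end
end

section
/- (Step 2 of the proof of Lemma 1.2) Let L > 0, α ∈ ℝ, m ∈ ℝ, and let φ ∈ H²(Ω) be 1-periodic in the in-plane variables with ∫_Ω φ dx = m, where Ω = [0,1)² × (0,1). Then ∫_Ω (L²αφ + Δ'φ)² dx ≥ L⁴α²m² + ( inf_{k ∈ 2πℤ², k ≠ 0} (L²α/|k|² − 1)² ) ∫_Ω (Δ'φ)² dx, where Δ'φ = ∂₁₁φ + ∂₂₂φ. -/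
open MeasureTheory Filter Real

noncomputable section

/-- the exponential `exp(-2πi n·x)` -/
def ex (n : Fin 3 → ℤ) (x : Pt 3) : ℂ :=
  Complex.exp (∑ i, (-(2 * π * Complex.I * (n i : ℂ))) * (x i : ℂ))

/-- Fourier coefficients on the cube -/
def fc (f : Pt 3 → ℝ) (n : Fin 3 → ℤ) : ℂ := ∫ x in cube 3, ex n x * (f x : ℂ)

lemma ex_eq (n : Fin 3 → ℤ) (x : Pt 3) :
    UnitAddTorus.mFourier (-n) (fun i => (x i : UnitAddCircle)) = ex n x := by
  simp only [UnitAddTorus.mFourier, ContinuousMap.coe_mk, fourier_coe_apply, ex, Complex.exp_sum]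
  refine Finset.prod_congr rfl fun i _ => ?_
  congr 1
  push_cast [Pi.neg_apply]
  ring

lemma ioc_box_ae : ({x : Fin 3 → ℝ | ∀ i, x i ∈ Set.Ioc ((0 : Fin 3 → ℝ) i) ((0 : Fin 3 → ℝ) i + 1)}
    : Set (Fin 3 → ℝ)) =ᵐ[volume] cube 3 := by
  have h := Measure.univ_pi_Ioc_ae_eq_Icc (μ := fun _ : Fin 3 => (volume : Measure ℝ))
    (f := (0 : Fin 3 → ℝ)) (g := 1)
  have e : {x : Fin 3 → ℝ | ∀ i, x i ∈ Set.Ioc ((0 : Fin 3 → ℝ) i) ((0 : Fin 3 → ℝ) i + 1)}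
      = Set.pi Set.univ fun i => Set.Ioc ((0 : Fin 3 → ℝ) i) ((1 : Fin 3 → ℝ) i) := by
    ext x; simp
  rw [e]; exact h

section
attribute [local instance] instMeasureSpaceUnitAddCircle
  instIsProbabilityMeasureUnitAddCircleVolume

lemma parseval (f : Pt 3 → ℝ) (hf : Continuous f) :
    HasSum (fun n => ‖fc f n‖ ^ 2) (∫ x in cube 3, (f x) ^ 2) := by
  let r : UnitAddTorus (Fin 3) → Pt 3 := fun t =>
    (UnitAddTorus.measurableEquivPiIoc (0 : Fin 3 → ℝ) t).1
  have hr : Measurable r :=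
    measurable_subtype_coe.comp (UnitAddTorus.measurableEquivPiIoc (0 : Fin 3 → ℝ)).measurable
  let F : UnitAddTorus (Fin 3) → ℂ := fun t => (f (r t) : ℂ)
  have hF : Measurable F := Complex.measurable_ofReal.comp (hf.measurable.comp hr)
  have hFx : ∀ x ∈ {x : Fin 3 → ℝ | ∀ i, x i ∈ Set.Ioc ((0 : Fin 3 → ℝ) i) ((0 : Fin 3 → ℝ) i + 1)},
      F (fun i => (x i : UnitAddCircle)) = f x := by
    intro x hx
    have : r (fun i => (x i : UnitAddCircle)) = x := by
      have := (UnitAddTorus.measurableEquivPiIoc (0 : Fin 3 → ℝ)).apply_symm_apply ⟨x, hx⟩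
      exact congrArg Subtype.val this
    simp only [F, this]
  have hms : MeasurableSet {x : Fin 3 → ℝ |
      ∀ i, x i ∈ Set.Ioc ((0 : Fin 3 → ℝ) i) ((0 : Fin 3 → ℝ) i + 1)} :=
    MeasurableSet.univ_pi' (fun i => measurableSet_Ioc)
  obtain ⟨C, hC⟩ := (isCompact_Icc (a := (0 : Fin 3 → ℝ)) (b := 1)).exists_bound_of_continuousOn
    hf.continuousOn
  have hrm : ∀ t, r t ∈ Set.Icc (0 : Fin 3 → ℝ) 1 := by
    intro t
    have h := (UnitAddTorus.measurableEquivPiIoc (0 : Fin 3 → ℝ) t).2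
    refine ⟨fun i => (h i).1.le, fun i => ?_⟩
    exact (h i).2.trans_eq (zero_add _)
  have hL : MemLp F 2 volume := by
    refine MemLp.of_bound hF.aestronglyMeasurable C (Eventually.of_forall fun t => ?_)
    simpa [F] using hC _ (hrm t)
  have hco := hL.coeFn_toLp
  have h := UnitAddTorus.hasSum_sq_mFourierCoeff (hL.toLp F)
  have e1 : (∫ t, ‖hL.toLp F t‖ ^ 2) = ∫ x in cube 3, (f x) ^ 2 := by
    calc (∫ t, ‖hL.toLp F t‖ ^ 2) = ∫ t, ‖F t‖ ^ 2 := by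
          apply integral_congr_ae
          filter_upwards [hco] with t ht
          rw [ht]
      _ = _ := by
          rw [UnitAddTorus.integral_preimage _ (0 : Fin 3 → ℝ), ← setIntegral_congr_set ioc_box_ae]
          refine setIntegral_congr_fun hms fun x hx => ?_
          simp only [hFx x hx]
          simp
  have e2 : ∀ n, UnitAddTorus.mFourierCoeff (hL.toLp F) n = fc f n := by
    intro n
    calc UnitAddTorus.mFourierCoeff (hL.toLp F) n = UnitAddTorus.mFourierCoeff F n := by
          apply integral_congr_ae
          filter_upwards [hco] with t ht
          rw [ht]
      _ = _ := by
          rw [UnitAddTorus.mFourierCoeff_eq_integral _ _ (0 : Fin 3 → ℝ), fc,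
            ← setIntegral_congr_set ioc_box_ae]
          refine setIntegral_congr_fun hms fun x hx => ?_
          simp only [hFx x hx, ex_eq, smul_eq_mul]
  simp only [e1, e2] at h
  exact h

end

lemma integral_deriv_zero (i : Fin 3) (g : Pt 3 → ℂ) (hg : ContDiff ℝ 1 g)
    (hp : ∀ x, g (x + Pi.single i 1) = g x) :
    ∫ x in cube 3, fderiv ℝ g x (Pi.single i 1) = 0 := by
  have hgc : Continuous fun x => fderiv ℝ g x (Pi.single i 1) :=
    (hg.continuous_fderiv one_ne_zero).clm_apply continuous_const
  have hsum : ∀ x, ∑ j, (if j = i then fderiv ℝ g x else 0) (Pi.single j 1)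
      = fderiv ℝ g x (Pi.single i 1) := by
    intro x
    rw [Finset.sum_eq_single i]
    · simp
    · intro j _ hj; simp [hj]
    · simp
  have h := integral_divergence_of_hasFDerivAt_off_countable' (E := ℂ) (n := 2) (0 : Fin 3 → ℝ) 1
    (by intro j; simp) (fun j => if j = i then g else 0)
    (fun j x => if j = i then fderiv ℝ g x else 0) ∅ Set.countable_empty
    (by
      intro j
      by_cases hj : j = i
      · simp only [hj, if_true]; exact hg.continuous.continuousOn
      · simp only [hj, if_false]; exact continuousOn_const)
    (by
      intro x _ j
      by_cases hj : j = i
      · simp only [hj, if_true]; exact (hg.differentiable one_ne_zero x).hasFDerivAt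
      · simp only [hj, if_false]; exact hasFDerivAt_const 0 x)
    (by
      simp only [hsum]
      exact hgc.continuousOn.integrableOn_compact isCompact_Icc)
  simp only [hsum] at h
  rw [cube, h]
  apply Finset.sum_eq_zero
  intro j _
  by_cases hj : j = i
  · subst hj
    simp only [if_true]
    rw [sub_eq_zero]
    congr 1
    ext y
    refine Eq.trans ?_ (hp (Fin.insertNth j ((0 : Fin 3 → ℝ) j) y))
    congr 1
    ext k
    refine Fin.succAboveCases j ?_ (fun l => ?_) k
    · simp
    · simp [Fin.succAbove_ne]
  · simp [hj]

lemma ex_contDiff (n : Fin 3 → ℤ) : ContDiff ℝ 1 (ex n) := by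
  unfold ex
  apply ContDiff.cexp
  apply ContDiff.sum
  intro i _
  apply contDiff_const.mul
  exact Complex.ofRealCLM.contDiff.comp (contDiff_apply ℝ ℝ i)

lemma ex_fderiv (n : Fin 3 → ℤ) (x : Pt 3) (i : Fin 3) :
    fderiv ℝ (ex n) x (Pi.single i 1) = -(2 * π * Complex.I * (n i : ℂ)) * ex n x := by
  have h1 : ∀ j : Fin 3, HasFDerivAt (fun x : Pt 3 => ((x j : ℝ) : ℂ))
      (Complex.ofRealCLM.comp (ContinuousLinearMap.proj j)) x := fun j =>
    (Complex.ofRealCLM.comp (ContinuousLinearMap.proj (R := ℝ) (φ := fun _ : Fin 3 => ℝ) j)).hasFDerivAt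
  have h2 := (HasFDerivAt.fun_sum (u := Finset.univ)
    (fun j _ => (h1 j).const_mul (-(2 * π * Complex.I * (n j : ℂ))))).cexp
  have h3 : HasFDerivAt (ex n) _ x := h2
  rw [h3.fderiv]
  simp only [_root_.smul_apply, _root_.sum_apply,
    ContinuousLinearMap.comp_apply, ContinuousLinearMap.proj_apply, Complex.ofRealCLM_apply,
    smul_eq_mul]
  rw [Finset.sum_eq_single (s := Finset.univ) (f := fun j => -(2 * π * Complex.I * (n j : ℂ)) *
    (((Pi.single i 1 : Pt 3) j : ℝ) : ℂ)) i]
  · simp only [ex, Pi.single_eq_same, Complex.ofReal_one]; ring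
  · intro j _ hj; simp [hj]
  · simp

lemma ex_periodic (n : Fin 3 → ℤ) (x : Pt 3) (i : Fin 3) :
    ex n (x + Pi.single i 1) = ex n x := by
  rw [← ex_eq, ← ex_eq]
  congr 1
  ext j
  by_cases hj : j = i
  · subst hj; simp
  · simp [hj]

lemma fc_pd (n : Fin 3 → ℤ) (i : Fin 3) (f : Pt 3 → ℝ) (hf : ContDiff ℝ 1 f)
    (hp : ∀ x, f (x + Pi.single i 1) = f x) :
    fc (pd i f) n = (2 * π * Complex.I * (n i : ℂ)) * fc f n := by
  have hfC : ContDiff ℝ 1 fun x => (f x : ℂ) := Complex.ofRealCLM.contDiff.comp hf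
  have h := integral_deriv_zero i (fun x => ex n x * (f x : ℂ)) ((ex_contDiff n).mul hfC)
    (fun x => by simp only [ex_periodic, hp])
  have hd : ∀ x, fderiv ℝ (fun x => ex n x * (f x : ℂ)) x (Pi.single i 1)
      = ex n x * (pd i f x : ℂ) - (2 * π * Complex.I * (n i : ℂ)) * (ex n x * (f x : ℂ)) := by
    intro x
    have h1 := ((ex_contDiff n).differentiable one_ne_zero x).hasFDerivAt
    have h2 : HasFDerivAt (fun x => (f x : ℂ)) (Complex.ofRealCLM.comp (fderiv ℝ f x)) x :=
      Complex.ofRealCLM.hasFDerivAt.comp x (hf.differentiable one_ne_zero x).hasFDerivAt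
    rw [(h1.fun_mul h2).fderiv]
    simp only [_root_.add_apply, _root_.smul_apply, ex_fderiv,
      ContinuousLinearMap.comp_apply, Complex.ofRealCLM_apply, smul_eq_mul, pd]
    ring
  simp only [hd] at h
  have hpc : Continuous (pd i f) :=
    (hf.continuous_fderiv one_ne_zero).clm_apply continuous_const
  have hc := (ex_contDiff n).continuous
  rw [integral_sub, integral_const_mul, sub_eq_zero] at h
  · exact h
  · exact (hc.mul (Complex.continuous_ofReal.comp hpc)).continuousOn.integrableOn_compact
      isCompact_Icc
  · exact (continuous_const.mul (hc.mul hfC.continuous)).continuousOn.integrableOn_compact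
      isCompact_Icc

lemma pd_contDiff {k m : ℕ} (i : Fin 3) (f : Pt 3 → ℝ) (hf : ContDiff ℝ k f) (hm : m + 1 ≤ k) :
    ContDiff ℝ m (pd i f) := by
  have : ContDiff ℝ m (fderiv ℝ f) := hf.fderiv_right (by exact_mod_cast hm)
  exact this.clm_apply contDiff_const

lemma pd_periodic (i : Fin 3) (f : Pt 3 → ℝ) (v : Pt 3) (hp : ∀ x, f (x + v) = f x) (x : Pt 3) :
    pd i f (x + v) = pd i f x := by
  have : (fun x => f (x + v)) = f := funext hp
  unfold pd
  rw [← fderiv_comp_add_right, this]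

lemma fc_pd2 (n : Fin 3 → ℤ) (i : Fin 3) (f : Pt 3 → ℝ) (hf : ContDiff ℝ 2 f)
    (hp : ∀ x, f (x + Pi.single i 1) = f x) :
    fc (pd2 i i f) n = -((4 * π ^ 2 * (n i : ℝ) ^ 2 : ℝ) : ℂ) * fc f n := by
  unfold pd2
  rw [fc_pd n i _ (by exact_mod_cast pd_contDiff (k := 2) (m := 1) i f (by exact_mod_cast hf) le_rfl)
    (pd_periodic i f _ hp), fc_pd n i f (hf.of_le (by norm_num)) hp]
  push_cast
  linear_combination 4 * π ^ 2 * (n i : ℂ) ^ 2 * fc f n * Complex.I_sq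

lemma fc_lin (n : Fin 3 → ℤ) (a : ℝ) (f g : Pt 3 → ℝ) (hf : Continuous f) (hg : Continuous g) :
    fc (fun x => a * f x + g x) n = a * fc f n + fc g n := by
  have hc := (ex_contDiff n).continuous
  unfold fc
  rw [← integral_const_mul, ← integral_add]
  · congr 1; ext x; push_cast; ring
  · exact (continuous_const.mul (hc.mul (Complex.continuous_ofReal.comp hf))).continuousOn.integrableOn_compact
      isCompact_Icc
  · exact (hc.mul (Complex.continuous_ofReal.comp hg)).continuousOn.integrableOn_compact
      isCompact_Icc

/-- Step 2 of the proof of Lemma 1.2. -/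
theorem step2_fourier_bound (L α m : ℝ) (hL : 0 < L) (φ : Pt 3 → ℝ)
    (hsm : ContDiff ℝ 2 φ) (hper : InPlanePeriodic φ)
    (hm : (∫ x in cube 3, φ x) = m) :
    (∫ x in cube 3, (L^2 * α * φ x + lap' φ x)^2) ≥
      L^4 * α^2 * m^2 +
        sInf {t : ℝ | ∃ k : ℤ × ℤ, k ≠ 0 ∧
            t = (L^2 * α / (4*π^2*((k.1 : ℝ)^2 + (k.2 : ℝ)^2)) - 1)^2} *
          (∫ x in cube 3, (lap' φ x)^2) := by
  set S := {t : ℝ | ∃ k : ℤ × ℤ, k ≠ 0 ∧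
            t = (L^2 * α / (4*π^2*((k.1 : ℝ)^2 + (k.2 : ℝ)^2)) - 1)^2} with hS
  have hbdd : BddBelow S := ⟨0, by rintro t ⟨k, _, rfl⟩; positivity⟩
  have hc2 : ∀ i, Continuous (pd2 i i φ) := fun i => by
    have h1 : ContDiff ℝ 1 (pd i φ) := by
      exact_mod_cast pd_contDiff (k := 2) (m := 1) i φ (by exact_mod_cast hsm) le_rfl
    exact (pd_contDiff (k := 1) (m := 0) i _ (by exact_mod_cast h1) le_rfl).continuous
  have hlc : Continuous (lap' φ) := (hc2 0).add (hc2 1)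
  have hφc := hsm.continuous
  have hlap : ∀ n, fc (lap' φ) n
      = -((4 * π ^ 2 * ((n 0 : ℝ) ^ 2 + (n 1 : ℝ) ^ 2) : ℝ) : ℂ) * fc φ n := by
    intro n
    have h := fc_lin n 1 (pd2 0 0 φ) (pd2 1 1 φ) (hc2 0) (hc2 1)
    have e : (fun x => 1 * pd2 0 0 φ x + pd2 1 1 φ x) = lap' φ := by
      ext x; simp [lap']
    rw [e, fc_pd2 n 0 φ hsm (fun x => (hper x).1), fc_pd2 n 1 φ hsm (fun x => (hper x).2)] at h
    rw [h]; push_cast; ring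
  have hP1 := parseval (fun x => L^2 * α * φ x + lap' φ x) ((continuous_const.mul hφc).add hlc)
  have hP2 := parseval (lap' φ) hlc
  have hone : HasSum (fun n : Fin 3 → ℤ => if n = 0 then L^4 * α^2 * m^2 else 0)
      (L^4 * α^2 * m^2) := hasSum_ite_eq 0 _
  refine hasSum_le (fun n => ?_) (hone.add (hP2.mul_left (sInf S))) hP1
  have hu : fc (fun x => L^2 * α * φ x + lap' φ x) n
      = ((L^2 * α - 4 * π ^ 2 * ((n 0 : ℝ) ^ 2 + (n 1 : ℝ) ^ 2) : ℝ) : ℂ) * fc φ n := by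
    rw [fc_lin n (L^2 * α) φ (lap' φ) hφc hlc, hlap]
    push_cast; ring
  rw [hu, hlap, norm_mul, norm_mul, norm_neg, Complex.norm_real, Complex.norm_real, mul_pow, mul_pow,
    Real.norm_eq_abs, Real.norm_eq_abs, sq_abs, sq_abs]
  by_cases h0 : n 0 = 0 ∧ n 1 = 0
  · rw [h0.1, h0.2]
    by_cases hn : n = 0
    · have hz : fc φ n = (m : ℂ) := by
        rw [hn, ← hm, ← integral_complex_ofReal]
        simp [fc, ex]
      rw [hz]
      simp [hn]
      apply le_of_eq; ring
    · simp [hn]; positivity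
  · have hn : n ≠ 0 := by
      rintro rfl; exact h0 ⟨rfl, rfl⟩
    have hpos : 0 < (n 0 : ℝ) ^ 2 + (n 1 : ℝ) ^ 2 := by
      rcases not_and_or.mp h0 with h | h
      · have : (n 0 : ℝ) ≠ 0 := by exact_mod_cast h
        positivity
      · have : (n 1 : ℝ) ≠ 0 := by exact_mod_cast h
        positivity
    have hle : sInf S ≤ (L^2 * α / (4*π^2*((n 0 : ℝ)^2 + (n 1 : ℝ)^2)) - 1)^2 :=
      csInf_le hbdd ⟨(n 0, n 1), fun h => h0 ⟨congrArg Prod.fst h, congrArg Prod.snd h⟩, rfl⟩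
    rw [if_neg hn, zero_add, ← mul_assoc]
    apply mul_le_mul_of_nonneg_right _ (sq_nonneg _)
    have hπ := Real.pi_pos
    calc _ ≤ (L^2 * α / (4*π^2*((n 0 : ℝ)^2 + (n 1 : ℝ)^2)) - 1)^2 *
          (4 * π ^ 2 * ((n 0 : ℝ) ^ 2 + (n 1 : ℝ) ^ 2)) ^ 2 :=
          mul_le_mul_of_nonneg_right hle (sq_nonneg _)
      _ = _ := by
          rw [← mul_pow, sub_mul, div_mul_cancel₀ _ (by positivity), one_mul]

end
end
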